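/- Let n ≥ 1 and let P be a symmetric polynomial in 2n+1 variables with complex coefficients. Then there exists a unique symmetric polynomial Q in n variables with complex coefficients such that for all nonzero complex numbers x_1, …, x_n, P(x_1, …, x_n, x_1^{-1}, …, x_n^{-1}, 1) = Q(x_1 + x_1^{-1}, …, x_n + x_n^{-1}). -/

import Mathlib

/-- Chebyshev polynomial of the first kind: T 0 = 1, T 1 = u, T (m+2) = 2u·T(m+1) − T m. -/
noncomputable def chebT : ℕ → ℂ → ℂ
  | 0, _ => 1
  | 1, u => u
  | (m+2), u => 2 * u * chebT (m+1) u - chebT m u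

/-- Chebyshev polynomial of the second kind: U 0 = 1, U 1 = 2u, U (m+2) = 2u·U(m+1) − U m. -/
noncomputable def chebU : ℕ → ℂ → ℂ
  | 0, _ => 1
  | 1, u => 2 * u
  | (m+2), u => 2 * u * chebU (m+1) u - chebU m u

/-- Monic integer Chebyshev polynomial: Tmonic 0 u = 1 and Tmonic m u = 2·T m (u/2) for m ≥ 1. -/
noncomputable def tmonic (m : ℕ) (u : ℂ) : ℂ := if m = 0 then 1 else 2 * chebT m (u / 2)

/-- Value of the elementary symmetric polynomial e_m at the family y. -/
noncomputable def esymmVal {ι : Type*} [Fintype ι] (m : ℕ) (y : ι → ℂ) : ℂ :=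
  ∑ s ∈ Finset.powersetCard m (Finset.univ : Finset ι), ∏ i ∈ s, y i

/-- Value of the complete homogeneous symmetric polynomial h_m at the family y:
the sum over all exponent vectors α with |α| = m of ∏ y i ^ α i. -/
noncomputable def hsymmVal {ι : Type*} [Fintype ι] [DecidableEq ι] (m : ℕ) (y : ι → ℂ) : ℂ :=
  ∑ α ∈ (Fintype.piFinset fun _ : ι => Finset.range (m+1)).filter (fun α => ∑ i, α i = m),
    ∏ i, y i ^ α i

/-- The symplectic alphabet x₁, …, xₙ, x₁⁻¹, …, xₙ⁻¹, indexed by `Fin n ⊕ Fin n`. -/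
noncomputable def sympAlph {n : ℕ} (x : Fin n → ℂ) : Fin n ⊕ Fin n → ℂ :=
  Sum.elim x fun j => (x j)⁻¹

open MvPolynomial in
/-- The generating polynomial in the variables `x_j + x_j⁻¹`. -/
noncomputable def genPoly (n : ℕ) : Polynomial (MvPolynomial (Fin n) ℂ) :=
  (∏ j : Fin n, (Polynomial.X ^ 2 + Polynomial.C (X j) * Polynomial.X + 1)) * (Polynomial.X + 1)

theorem genPoly_symm (n k : ℕ) : ((genPoly n).coeff k).IsSymmetric := by
  intro e
  have h : (genPoly n).map (MvPolynomial.rename e : _ →ₐ[ℂ] MvPolynomial (Fin n) ℂ).toRingHom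
      = genPoly n := by
    simp only [genPoly, Polynomial.map_mul, Polynomial.map_prod, Polynomial.map_add,
      Polynomial.map_pow, Polynomial.map_X, Polynomial.map_C, Polynomial.map_one]
    have hprod : ∏ j : Fin n, (Polynomial.X ^ 2 + Polynomial.C
        ((MvPolynomial.rename e : _ →ₐ[ℂ] MvPolynomial (Fin n) ℂ).toRingHom (MvPolynomial.X j))
          * Polynomial.X + 1)
        = ∏ j : Fin n, (Polynomial.X ^ 2 + Polynomial.C (MvPolynomial.X j : MvPolynomial (Fin n) ℂ)
          * Polynomial.X + 1) := by
      refine Fintype.prod_equiv e _ _ fun j => ?_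
      have : (MvPolynomial.rename e : _ →ₐ[ℂ] MvPolynomial (Fin n) ℂ).toRingHom
          (MvPolynomial.X j) = MvPolynomial.X (e j) := MvPolynomial.rename_X e j
      rw [this]
    rw [hprod]
  have h2 := congrArg (fun p => Polynomial.coeff p k) h
  simp only [Polynomial.coeff_map] at h2
  exact h2

theorem genPoly_eval (n k : ℕ) (hk : k ≤ Fintype.card ((Fin n ⊕ Fin n) ⊕ Unit))
    (x : Fin n → ℂ) (hx : ∀ i, x i ≠ 0) :
    MvPolynomial.eval (Sum.elim (sympAlph x) fun _ => (1 : ℂ))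
      (MvPolynomial.esymm ((Fin n ⊕ Fin n) ⊕ Unit) ℂ
        (Fintype.card ((Fin n ⊕ Fin n) ⊕ Unit) - k))
      = MvPolynomial.eval (fun j => x j + (x j)⁻¹) ((genPoly n).coeff k) := by
  rw [← MvPolynomial.prod_X_add_C_coeff _ _ _ hk, ← Polynomial.coeff_map,
    ← Polynomial.coeff_map]
  congr 1
  simp only [genPoly, Polynomial.map_mul, Polynomial.map_prod, Polynomial.map_add,
      Polynomial.map_pow, Polynomial.map_X, Polynomial.map_C, Polynomial.map_one,
      Fintype.prod_sum_type, MvPolynomial.eval_X, Sum.elim_inl, Sum.elim_inr, sympAlph]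
  rw [← Finset.prod_mul_distrib]
  simp only [Finset.univ_unique, Finset.prod_const, Finset.card_singleton, pow_one, map_one]
  congr 1
  refine Finset.prod_congr rfl fun j _ => ?_
  have h1 : (Polynomial.C (x j) * Polynomial.C (x j)⁻¹ : Polynomial ℂ) = 1 := by
    rw [← Polynomial.C_mul, mul_inv_cancel₀ (hx j), Polynomial.C_1]
  rw [Polynomial.C_add]
  linear_combination h1

theorem exists_add_inv (y : ℂ) : ∃ x : ℂ, x ≠ 0 ∧ x + x⁻¹ = y := by
  obtain ⟨s, hs⟩ := IsAlgClosed.exists_pow_nat_eq (y ^ 2 - 4) (n := 2) (by norm_num)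
  have h : (y + s) / 2 * ((y - s) / 2) = 1 := by linear_combination -hs / 4
  refine ⟨(y + s) / 2, left_ne_zero_of_mul_eq_one h, ?_⟩
  rw [inv_eq_of_mul_eq_one_right h]
  ring

/-- For every symmetric polynomial `P` in 2n+1 variables there is a unique symmetric
polynomial `Q` in n variables with
`P(x₁,…,xₙ,x₁⁻¹,…,xₙ⁻¹,1) = Q(x₁+x₁⁻¹,…,xₙ+xₙ⁻¹)` for all nonzero `x₁,…,xₙ`. -/
theorem exists_unique_symm_of_odd_symplectic (n : ℕ) (hn : 1 ≤ n)
    (P : MvPolynomial ((Fin n ⊕ Fin n) ⊕ Unit) ℂ) (hP : P.IsSymmetric) :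
    ∃! Q : MvPolynomial (Fin n) ℂ, Q.IsSymmetric ∧
      ∀ x : Fin n → ℂ, (∀ i, x i ≠ 0) →
        MvPolynomial.eval (Sum.elim (sympAlph x) fun _ => (1 : ℂ)) P
          = MvPolynomial.eval (fun j => x j + (x j)⁻¹) Q := by
  have hu : ∀ Q R : MvPolynomial (Fin n) ℂ, (∀ x : Fin n → ℂ, (∀ i, x i ≠ 0) →
      MvPolynomial.eval (fun j => x j + (x j)⁻¹) Q
        = MvPolynomial.eval (fun j => x j + (x j)⁻¹) R) → Q = R := by
    intro Q R h
    refine MvPolynomial.funext fun y => ?_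
    choose x hx0 hx using fun j => exists_add_inv (y j)
    have := h x hx0
    simpa only [hx] using this
  obtain ⟨N, hN⟩ : ∃ N, N = Fintype.card ((Fin n ⊕ Fin n) ⊕ Unit) := ⟨_, rfl⟩
  obtain ⟨p, hp⟩ := MvPolynomial.esymmAlgHom_surjective (σ := (Fin n ⊕ Fin n) ⊕ Unit) ℂ
    (n := N) hN.ge ⟨P, hP⟩
  have hp' := congrArg Subtype.val hp
  rw [MvPolynomial.esymmAlgHom_apply] at hp'
  refine existsUnique_of_exists_of_unique
    ⟨MvPolynomial.aeval (fun i : Fin N => (genPoly n).coeff (N - (i + 1))) p, ?_, ?_⟩ ?_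
  · intro e
    rw [← AlgHom.comp_apply, MvPolynomial.comp_aeval]
    congr 2
    funext i
    exact genPoly_symm n _ e
  · intro x hx
    simp only at hp'
    rw [← hp', MvPolynomial.aeval_def, MvPolynomial.aeval_def, MvPolynomial.eval_eval₂,
      MvPolynomial.eval_eval₂]
    have hc : ∀ i : Fin N, N - (N - (i + 1 : ℕ)) = i + 1 := fun i => by omega
    congr 1
    · ext <;> simp
    · funext i
      rw [← genPoly_eval n _ ((Nat.sub_le _ _).trans hN.le) x hx, ← hN, hc]
  · rintro Q R ⟨-, hQ⟩ ⟨-, hR⟩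
    exact hu Q R fun x hx => (hQ x hx).symm.trans (hR x hx)
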